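/- Let p, q ≥ 1, let Ω be a proper quasi-homogeneous domain of Ein^{p,q}, and let a ∈ ∂Ω be photon-extremal. For all sequences (x_k), (y_k) in Ω such that x_k → a in ℙ(ℝⁿ) and such that there is M > 0 with δ^Ω(x_k, y_k) ≤ M for all k, one has y_k → a. -/

import Mathlib

noncomputable section

open scoped LinearAlgebra.Projectivization ENNReal
open Projectivization Filter Topology Set

variable {W : Type} [AddCommGroup W] [Module ℝ W] [TopologicalSpace W]

instance projTopology : TopologicalSpace (ℙ ℝ W) :=
  inferInstanceAs (TopologicalSpace (Quotient (projectivizationSetoid ℝ W)))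

/-- The null cone in projective space determined by a quadratic form `v ↦ Bf v v`. -/
def einSet (Bf : W → W → ℝ) : Set (ℙ ℝ W) := {x | Bf x.rep x.rep = 0}

/-- The lightcone of a point of the Einstein universe. -/
def lightcone (Bf : W → W → ℝ) (x : ℙ ℝ W) : Set (ℙ ℝ W) :=
  {y | y ∈ einSet Bf ∧ Bf x.rep y.rep = 0}

/-- A domain: nonempty connected open subset of the Einstein universe
(open and connected in the subspace topology of `einSet Bf`). -/
def IsEinDomain (Bf : W → W → ℝ) (Ω : Set (ℙ ℝ W)) : Prop :=
  Ω ⊆ einSet Bf ∧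
  IsOpen (Subtype.val ⁻¹' Ω : Set (einSet Bf)) ∧
  IsConnected (Subtype.val ⁻¹' Ω : Set (einSet Bf))

/-- A proper domain: some lightcone misses the closure. -/
def IsProperDomain (Bf : W → W → ℝ) (Ω : Set (ℙ ℝ W)) : Prop :=
  IsEinDomain Bf Ω ∧ ∃ x ∈ einSet Bf, closure Ω ∩ lightcone Bf x = ∅

/-- The projective transformation induced by a linear automorphism. -/
def projMap (g : W ≃ₗ[ℝ] W) : ℙ ℝ W → ℙ ℝ W :=
  Projectivization.map (g : W →ₗ[ℝ] W) g.injective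

/-- The conformal group of a domain. -/
def Conf (Bf : W → W → ℝ) (Ω : Set (ℙ ℝ W)) : Set (W ≃ₗ[ℝ] W) :=
  {g | (∀ v, Bf (g v) (g v) = Bf v v) ∧ projMap g '' Ω = Ω}

/-- Quasi-homogeneity of a domain. -/
def IsQuasiHomogeneous (Bf : W → W → ℝ) (Ω : Set (ℙ ℝ W)) : Prop :=
  ∃ K : Set (ℙ ℝ W), K ⊆ Ω ∧ IsCompact K ∧
    Ω = ⋃ g ∈ Conf Bf Ω, projMap g '' K

/-- Dual convexity: every frontier point admits a supporting lightcone. -/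
def IsDuallyConvex (Bf : W → W → ℝ) (Ω : Set (ℙ ℝ W)) : Prop :=
  ∀ a ∈ closure Ω \ Ω, ∃ b ∈ einSet Bf, a ∈ lightcone Bf b ∧ lightcone Bf b ∩ Ω = ∅

/-- The hyperbolic distance on the interval `(-1,1)`. -/
def dHyp (s t : ℝ) : ℝ := |Real.log (((1 + t) * (1 - s)) / ((1 - t) * (1 + s)))|

/-- The interval of parameters. -/
def II : Set ℝ := Set.Ioo (-1 : ℝ) 1

/-- A projectively parametrized lightlike geodesic with values in `Ω`. -/
def IsLightGeodesic (Bf : W → W → ℝ) (Ω : Set (ℙ ℝ W)) (α : ℝ → ℙ ℝ W) : Prop :=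
  ∃ (u w : W) (a b c d : ℝ),
    LinearIndependent ℝ ![u, w] ∧
    Bf u u = 0 ∧ Bf u w = 0 ∧ Bf w w = 0 ∧
    a * d - b * c ≠ 0 ∧
    ∀ t ∈ II, ∃ h : (a * t + b) • u + (c * t + d) • w ≠ 0,
      α t = Projectivization.mk ℝ ((a * t + b) • u + (c * t + d) • w) h ∧ α t ∈ Ω

/-- `IsChainCost Bf Ω x y N c` : there is a chain of index `N` from `x` to `y` in `Ω`
whose cost is `c`. -/
def IsChainCost (Bf : W → W → ℝ) (Ω : Set (ℙ ℝ W)) (x y : ℙ ℝ W) (N : ℕ) (c : ℝ) : Prop :=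
  ∃ (xs : Fin (N + 1) → ℙ ℝ W) (αs : Fin N → ℝ → ℙ ℝ W) (ss ts : Fin N → ℝ),
    xs 0 = x ∧ xs (Fin.last N) = y ∧
    (∀ i : Fin N, IsLightGeodesic Bf Ω (αs i) ∧ ss i ∈ II ∧ ts i ∈ II ∧
      αs i (ss i) = xs i.castSucc ∧ αs i (ts i) = xs i.succ) ∧
    c = ∑ i : Fin N, dHyp (ss i) (ts i)

/-- The Markowitz pseudodistance of `Ω`, with values in `[0,∞]`. -/
def markowitz (Bf : W → W → ℝ) (Ω : Set (ℙ ℝ W)) (x y : ℙ ℝ W) : ℝ≥0∞ :=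
  sInf {e | ∃ (N : ℕ) (c : ℝ), 1 ≤ N ∧ IsChainCost Bf Ω x y N c ∧ e = ENNReal.ofReal c}

/-- The Markowitz pseudodistance restricted to chains of index at most `Nmax`. -/
def markowitzN (Bf : W → W → ℝ) (Ω : Set (ℙ ℝ W)) (Nmax : ℕ) (x y : ℙ ℝ W) : ℝ≥0∞ :=
  sInf {e | ∃ (N : ℕ) (c : ℝ), 1 ≤ N ∧ N ≤ Nmax ∧ IsChainCost Bf Ω x y N c ∧
    e = ENNReal.ofReal c}

/-- The projectivization of a linear subspace. -/
def projSet (Pl : Submodule ℝ W) : Set (ℙ ℝ W) := {y | y.rep ∈ Pl}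

/-- A photon subspace: a totally isotropic plane. -/
def IsPhotonSub (Bf : W → W → ℝ) (Pl : Submodule ℝ W) : Prop :=
  Module.finrank ℝ Pl = 2 ∧ ∀ u ∈ Pl, ∀ w ∈ Pl, Bf u w = 0

/-- Photon-extremal points of the frontier of `Ω`. -/
def IsPhotonExtremal (Bf : W → W → ℝ) (Ω : Set (ℙ ℝ W)) (a : ℙ ℝ W) : Prop :=
  a ∈ closure Ω \ Ω ∧
  ∀ Pl : Submodule ℝ W, IsPhotonSub Bf Pl → a.rep ∈ Pl →
    ¬ ∃ U : Set (ℙ ℝ W), IsOpen U ∧ a ∈ U ∧ U ∩ projSet Pl ⊆ closure Ω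

/-- A maximal projectively parametrized lightlike geodesic in `Ω`: its image is
a connected component of `ℙ(Pl) ∩ Ω`. -/
def IsMaxLightGeodesic (Bf : W → W → ℝ) (Ω : Set (ℙ ℝ W)) (α : ℝ → ℙ ℝ W) : Prop :=
  ∃ (u w : W) (a b c d : ℝ),
    LinearIndependent ℝ ![u, w] ∧
    Bf u u = 0 ∧ Bf u w = 0 ∧ Bf w w = 0 ∧
    a * d - b * c ≠ 0 ∧
    (∀ t ∈ II, ∃ h : (a * t + b) • u + (c * t + d) • w ≠ 0,
      α t = Projectivization.mk ℝ ((a * t + b) • u + (c * t + d) • w) h ∧ α t ∈ Ω) ∧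
    α '' II = connectedComponentIn (projSet (Submodule.span ℝ {u, w}) ∩ Ω) (α 0)

/-- The coordinate bilinear form of signature `(p+1, q+1)` on `ℝⁿ`, `n = p+q+2`. -/
def bForm (p q : ℕ) (v w : Fin (p + q + 2) → ℝ) : ℝ :=
  ∑ i : Fin (p + q + 2), (if (i : ℕ) ≤ p then (-1 : ℝ) else 1) * v i * w i

section Helpers

variable {p q : ℕ}

lemma bForm_comm (v w : Fin (p + q + 2) → ℝ) : bForm p q v w = bForm p q w v := by
  unfold bForm; exact Finset.sum_congr rfl fun i _ => by ring

lemma bForm_add_left (u v w : Fin (p + q + 2) → ℝ) :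
    bForm p q (u + v) w = bForm p q u w + bForm p q v w := by
  unfold bForm; rw [← Finset.sum_add_distrib]
  exact Finset.sum_congr rfl fun i _ => by simp only [Pi.add_apply]; ring

lemma bForm_smul_left (c : ℝ) (v w : Fin (p + q + 2) → ℝ) :
    bForm p q (c • v) w = c * bForm p q v w := by
  unfold bForm; rw [Finset.mul_sum]
  exact Finset.sum_congr rfl fun i _ => by simp only [Pi.smul_apply, smul_eq_mul]; ring

lemma bForm_add_right (u v w : Fin (p + q + 2) → ℝ) :
    bForm p q w (u + v) = bForm p q w u + bForm p q w v := by
  rw [bForm_comm, bForm_add_left, bForm_comm u, bForm_comm v]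

lemma bForm_smul_right (c : ℝ) (v w : Fin (p + q + 2) → ℝ) :
    bForm p q w (c • v) = c * bForm p q w v := by
  rw [bForm_comm, bForm_smul_left, bForm_comm v]

lemma bForm_sub_left (u v w : Fin (p + q + 2) → ℝ) :
    bForm p q (u - v) w = bForm p q u w - bForm p q v w := by
  have : u - v = u + (-1 : ℝ) • v := by module
  rw [this, bForm_add_left, bForm_smul_left]; ring

lemma bForm_sub_right (u v w : Fin (p + q + 2) → ℝ) :
    bForm p q w (u - v) = bForm p q w u - bForm p q w v := by
  rw [bForm_comm, bForm_sub_left, bForm_comm u, bForm_comm v]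

lemma bForm_zero_right (w : Fin (p + q + 2) → ℝ) : bForm p q w 0 = 0 := by
  simp [bForm]

lemma bForm_continuous :
    Continuous fun v : (Fin (p + q + 2) → ℝ) × (Fin (p + q + 2) → ℝ) => bForm p q v.1 v.2 := by
  unfold bForm; fun_prop

lemma bForm_continuous' {X : Type*} [TopologicalSpace X] {f g : X → (Fin (p + q + 2) → ℝ)}
    (hf : Continuous f) (hg : Continuous g) : Continuous fun x => bForm p q (f x) (g x) :=
  bForm_continuous.comp (hf.prodMk hg)

lemma bForm_tendsto {X : Type*} {l : Filter X} {f g : X → (Fin (p + q + 2) → ℝ)}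
    {u v : Fin (p + q + 2) → ℝ}
    (hf : Tendsto f l (𝓝 u)) (hg : Tendsto g l (𝓝 v)) :
    Tendsto (fun x => bForm p q (f x) (g x)) l (𝓝 (bForm p q u v)) :=
  (bForm_continuous.tendsto (u, v)).comp (hf.prodMk_nhds hg)

/-- The section of projective space over the affine chart `B(e, ·) = 1`. -/
def sig (e : Fin (p + q + 2) → ℝ) (x : ℙ ℝ (Fin (p + q + 2) → ℝ)) : Fin (p + q + 2) → ℝ :=
  (bForm p q e x.rep)⁻¹ • x.rep

lemma sig_mk (e v : Fin (p + q + 2) → ℝ) (h : v ≠ 0) :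
    sig e (Projectivization.mk ℝ v h) = (bForm p q e v)⁻¹ • v := by
  obtain ⟨a, ha⟩ := Projectivization.exists_smul_eq_mk_rep ℝ v h
  have ha0 : (a : ℝ) ≠ 0 := a.ne_zero
  unfold sig
  rw [← ha, Units.smul_def, bForm_smul_right, smul_smul]
  congr 1
  by_cases hb : bForm p q e v = 0
  · simp [hb]
  · field_simp

lemma isOpenQuotientMap_mk :
    IsOpenQuotientMap (fun v : {v : Fin (p + q + 2) → ℝ // v ≠ 0} =>
      Projectivization.mk ℝ v.1 v.2) := by
  refine ⟨?_, ?_, ?_⟩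
  · intro x
    exact ⟨⟨x.rep, x.rep_nonzero⟩, x.mk_rep⟩
  · exact continuous_quotient_mk'
  · have : ContinuousConstSMul ℝˣ {v : Fin (p + q + 2) → ℝ // v ≠ 0} := by
      refine ⟨fun c => ?_⟩
      refine Continuous.subtype_mk (f := fun v : {v : Fin (p + q + 2) → ℝ // v ≠ 0} => c • v.1) ?_ _
      fun_prop
    intro U hU
    refine (isQuotientMap_quotient_mk' (s := projectivizationSetoid ℝ
      (Fin (p + q + 2) → ℝ))).isOpen_preimage.1 ?_
    let _ := projectivizationSetoid ℝ (Fin (p + q + 2) → ℝ)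
    have e : ((Quotient.mk' : _ → Quotient (projectivizationSetoid ℝ (Fin (p + q + 2) → ℝ))) ⁻¹'
        ((fun v : {v : Fin (p + q + 2) → ℝ // v ≠ 0} => Projectivization.mk ℝ v.1 v.2) '' U)) =
        ⋃ c : ℝˣ, (fun v : {v : Fin (p + q + 2) → ℝ // v ≠ 0} => c • v) ⁻¹' U := by
      ext v
      simp only [Set.mem_preimage, Set.mem_iUnion]
      constructor
      · rintro ⟨u, hu, huv⟩
        have huv' : Projectivization.mk ℝ u.1 u.2 = Projectivization.mk ℝ v.1 v.2 := huv
        rw [Projectivization.mk_eq_mk_iff] at huv'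
        obtain ⟨c, hc⟩ := huv'
        refine ⟨c, ?_⟩
        have : c • v = u := Subtype.ext hc
        rwa [this]
      · rintro ⟨c, hc⟩
        refine ⟨c • v, hc, ?_⟩
        have : Projectivization.mk ℝ (c • v).1 (c • v).2 = Projectivization.mk ℝ v.1 v.2 := by
          rw [Projectivization.mk_eq_mk_iff]
          exact ⟨c, rfl⟩
        exact this
    exact e ▸ isOpen_iUnion fun c => hU.preimage (continuous_const_smul c)

lemma sig_continuousAt (e : Fin (p + q + 2) → ℝ) (x : ℙ ℝ (Fin (p + q + 2) → ℝ))
    (hx : bForm p q e x.rep ≠ 0) : ContinuousAt (sig e) x := by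
  have h := (isOpenQuotientMap_mk (p := p) (q := q)).continuousAt_comp_iff
    (g := sig e) (x := ⟨x.rep, x.rep_nonzero⟩)
  simp only [Projectivization.mk_rep] at h
  rw [← h]
  have : (sig e ∘ fun v : {v : Fin (p + q + 2) → ℝ // v ≠ 0} =>
      Projectivization.mk ℝ v.1 v.2) = fun v => (bForm p q e v.1)⁻¹ • v.1 := by
    funext v; exact sig_mk e v.1 v.2
  rw [this]
  have hc : Continuous fun v : {v : Fin (p + q + 2) → ℝ // v ≠ 0} => bForm p q e v.1 :=
    bForm_continuous' continuous_const continuous_subtype_val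
  exact (hc.continuousAt.inv₀ hx).smul continuous_subtype_val.continuousAt

lemma ne_zero_of_bForm {e v : Fin (p + q + 2) → ℝ} (h : bForm p q e v = 1) : v ≠ 0 := by
  rintro rfl; rw [bForm_zero_right] at h; exact zero_ne_one h

lemma bForm_sig {e : Fin (p + q + 2) → ℝ} {x : ℙ ℝ (Fin (p + q + 2) → ℝ)}
    (hx : bForm p q e x.rep ≠ 0) : bForm p q e (sig e x) = 1 := by
  unfold sig; rw [bForm_smul_right, inv_mul_cancel₀ hx]

lemma mk_sig {e : Fin (p + q + 2) → ℝ} {x : ℙ ℝ (Fin (p + q + 2) → ℝ)}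
    (hx : bForm p q e x.rep ≠ 0) (h : sig e x ≠ 0) :
    Projectivization.mk ℝ (sig e x) h = x := by
  conv_rhs => rw [← x.mk_rep]
  rw [Projectivization.mk_eq_mk_iff']
  exact ⟨_, rfl⟩

lemma sig_mk_of_one {e v : Fin (p + q + 2) → ℝ} (h1 : bForm p q e v = 1) (h : v ≠ 0) :
    sig e (Projectivization.mk ℝ v h) = v := by
  rw [sig_mk, h1]; simp

lemma rep_mk_smul (v : Fin (p + q + 2) → ℝ) (h : v ≠ 0) :
    ∃ a : ℝ, a ≠ 0 ∧ (Projectivization.mk ℝ v h).rep = a • v := by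
  obtain ⟨a, ha⟩ := Projectivization.exists_smul_eq_mk_rep ℝ v h
  exact ⟨a, a.ne_zero, ha.symm⟩

lemma mk_mem_einSet (v : Fin (p + q + 2) → ℝ) (h : v ≠ 0) :
    Projectivization.mk ℝ v h ∈ einSet (bForm p q) ↔ bForm p q v v = 0 := by
  obtain ⟨a, ha, hr⟩ := rep_mk_smul v h
  simp only [einSet, Set.mem_ofPred_eq]
  rw [hr, bForm_smul_left, bForm_smul_right]
  simp [ha]

lemma tendsto_mk {X : Type*} {l : Filter X} {f : X → Fin (p + q + 2) → ℝ}
    {v : Fin (p + q + 2) → ℝ} (hf : Tendsto f l (𝓝 v)) (h : ∀ x, f x ≠ 0) (hv : v ≠ 0) :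
    Tendsto (fun x => Projectivization.mk ℝ (f x) (h x)) l (𝓝 (Projectivization.mk ℝ v hv)) := by
  have hc := (isOpenQuotientMap_mk (p := p) (q := q)).continuous.tendsto ⟨v, hv⟩
  have h2 : Tendsto (fun x => (⟨f x, h x⟩ : {v : Fin (p + q + 2) → ℝ // v ≠ 0})) l (𝓝 ⟨v, hv⟩) := by
    rw [tendsto_subtype_rng]; exact hf
  exact hc.comp h2

/-- One lightlike segment of cost at most `c`. -/
def Step (Ω : Set (ℙ ℝ (Fin (p + q + 2) → ℝ))) (x y : ℙ ℝ (Fin (p + q + 2) → ℝ)) (c : ℝ) : Prop :=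
  ∃ (α : ℝ → ℙ ℝ (Fin (p + q + 2) → ℝ)) (s t : ℝ), IsLightGeodesic (bForm p q) Ω α ∧
    s ∈ II ∧ t ∈ II ∧ α s = x ∧ α t = y ∧ dHyp s t ≤ c

/-- Chains of lightlike segments. -/
inductive Ch (Ω : Set (ℙ ℝ (Fin (p + q + 2) → ℝ))) :
    ℙ ℝ (Fin (p + q + 2) → ℝ) → ℙ ℝ (Fin (p + q + 2) → ℝ) → ℝ → Prop
  | nil (x) : Ch Ω x x 0
  | cons (x y z) (c d : ℝ) : Step Ω x y c → 0 ≤ c → Ch Ω y z d → Ch Ω x z (c + d)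

lemma Ch.nonneg {Ω : Set (ℙ ℝ (Fin (p + q + 2) → ℝ))} {x y c} (h : Ch Ω x y c) : 0 ≤ c := by
  induction h with
  | nil => exact le_rfl
  | cons x y z c d h1 h2 h3 ih => linarith

lemma Ch.of_chain {Ω : Set (ℙ ℝ (Fin (p + q + 2) → ℝ))} (N : ℕ) :
    ∀ {x y c}, IsChainCost (bForm p q) Ω x y N c → Ch Ω x y c := by
  induction N with
  | zero =>
    rintro x y c ⟨xs, αs, ss, ts, h0, h1, -, hc⟩
    have : x = y := by rw [← h0, ← h1]; rfl
    subst this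
    simp at hc
    subst hc; exact .nil x
  | succ N ih =>
    rintro x y c ⟨xs, αs, ss, ts, h0, h1, h2, hc⟩
    rw [Fin.sum_univ_succ] at hc
    rw [hc]
    obtain ⟨g1, g2, g3, g4, g5⟩ := h2 0
    refine .cons x (xs 1) y _ _ ⟨αs 0, ss 0, ts 0, g1, g2, g3, ?_, ?_, le_rfl⟩ (abs_nonneg _) (ih ?_)
    · rw [g4, ← h0]; rfl
    · rw [g5]; rfl
    · exact ⟨fun i => xs i.succ, fun i => αs i.succ, fun i => ss i.succ, fun i => ts i.succ,
        rfl, h1, fun i => h2 i.succ, rfl⟩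

lemma conf_bForm {g : (Fin (p + q + 2) → ℝ) ≃ₗ[ℝ] (Fin (p + q + 2) → ℝ)}
    (hg : ∀ v, bForm p q (g v) (g v) = bForm p q v v) (v w) :
    bForm p q (g v) (g w) = bForm p q v w := by
  have h := hg (v + w)
  rw [map_add] at h
  simp only [bForm_add_left, bForm_add_right, hg] at h
  rw [bForm_comm (g w), bForm_comm w v] at h
  linarith

lemma projMap_mk (g : (Fin (p + q + 2) → ℝ) ≃ₗ[ℝ] (Fin (p + q + 2) → ℝ)) (v) (h : v ≠ 0) :
    projMap g (Projectivization.mk ℝ v h) =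
      Projectivization.mk ℝ (g v) (by simpa using h) := by
  unfold projMap; rw [Projectivization.map_mk]; rfl

lemma projMap_symm_apply (g : (Fin (p + q + 2) → ℝ) ≃ₗ[ℝ] (Fin (p + q + 2) → ℝ)) (x) :
    projMap g.symm (projMap g x) = x := by
  rw [← x.mk_rep, projMap_mk, projMap_mk]; simp

lemma projMap_apply_symm (g : (Fin (p + q + 2) → ℝ) ≃ₗ[ℝ] (Fin (p + q + 2) → ℝ)) (x) :
    projMap g (projMap g.symm x) = x := by
  rw [← x.mk_rep, projMap_mk, projMap_mk]; simp

lemma conf_symm {Ω : Set (ℙ ℝ (Fin (p + q + 2) → ℝ))} {g} (hg : g ∈ Conf (bForm p q) Ω) :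
    g.symm ∈ Conf (bForm p q) Ω := by
  refine ⟨fun v => ?_, ?_⟩
  · rw [← hg.1 (g.symm v)]; simp
  · conv_lhs => rw [← hg.2]
    rw [← Set.image_comp]
    have : projMap g.symm ∘ projMap g = id := by funext x; exact projMap_symm_apply g x
    rw [this, Set.image_id]

lemma conf_mem {Ω : Set (ℙ ℝ (Fin (p + q + 2) → ℝ))} {g} (hg : g ∈ Conf (bForm p q) Ω) {x}
    (hx : x ∈ Ω) : projMap g x ∈ Ω := by
  rw [← hg.2]; exact ⟨x, hx, rfl⟩

lemma Step.map {Ω : Set (ℙ ℝ (Fin (p + q + 2) → ℝ))} {g} (hg : g ∈ Conf (bForm p q) Ω) {x y c}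
    (h : Step Ω x y c) : Step Ω (projMap g x) (projMap g y) c := by
  obtain ⟨α, s, t, ⟨u, w, a, b, c', d, hli, huu, huw, hww, hdet, hα⟩, hs, ht, rfl, rfl, hd⟩ := h
  refine ⟨fun t => projMap g (α t), s, t, ⟨g u, g w, a, b, c', d, ?_, ?_, ?_, ?_, hdet, ?_⟩,
    hs, ht, rfl, rfl, hd⟩
  · have := hli.map' (g : (Fin (p + q + 2) → ℝ) →ₗ[ℝ] (Fin (p + q + 2) → ℝ)) g.ker
    have e : ((g : (Fin (p + q + 2) → ℝ) →ₗ[ℝ] (Fin (p + q + 2) → ℝ)) ∘ ![u, w]) =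
        ![g u, g w] := by
      funext i; fin_cases i <;> rfl
    rwa [e] at this
  · rw [conf_bForm hg.1, huu]
  · rw [conf_bForm hg.1, huw]
  · rw [conf_bForm hg.1, hww]
  · intro t ht
    obtain ⟨hne, h1, h2⟩ := hα t ht
    have e : (a * t + b) • g u + (c' * t + d) • g w = g ((a * t + b) • u + (c' * t + d) • w) := by
      simp
    refine ⟨?_, ?_, conf_mem hg h2⟩
    · rw [e]; exact (LinearEquiv.map_ne_zero_iff g).2 hne
    · simp only [h1, projMap_mk, e]

lemma Ch.map {Ω : Set (ℙ ℝ (Fin (p + q + 2) → ℝ))} {g} (hg : g ∈ Conf (bForm p q) Ω) {x y c}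
    (h : Ch Ω x y c) : Ch Ω (projMap g x) (projMap g y) c := by
  induction h with
  | nil => exact .nil _
  | cons x y z c d h1 h2 h3 ih => exact .cons _ _ _ _ _ (h1.map hg) h2 ih

lemma Step.mem {Ω : Set (ℙ ℝ (Fin (p + q + 2) → ℝ))} {x y c}
    (h : Step Ω x y c) : x ∈ Ω ∧ y ∈ Ω := by
  obtain ⟨α, s, t, ⟨u, w, a, b, c', d, hli, huu, huw, hww, hdet, hα⟩, hs, ht, rfl, rfl, hd⟩ := h
  exact ⟨(hα s hs).2.2, (hα t ht).2.2⟩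

lemma scal_aux {s t P τ E : ℝ} (hs : s ∈ II) (ht : t ∈ II) (hP : |P| ≤ 1)
    (h1 : (1 + t) * (1 - s) ≤ E * ((1 - t) * (1 + s)))
    (h2 : (1 - t) * (1 + s) ≤ E * ((1 + t) * (1 - s))) (hτ : |τ| * (E - 1) < 1) :
    ∃ u ∈ II, u * P + 1 ≠ 0 ∧
      (u * P + 1)⁻¹ = (s * P + 1)⁻¹ + τ * ((t * P + 1)⁻¹ - (s * P + 1)⁻¹) ∧
      (u * P + 1)⁻¹ * u = (s * P + 1)⁻¹ * s + τ * ((t * P + 1)⁻¹ * t - (s * P + 1)⁻¹ * s) := by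
  obtain ⟨hs1, hs2⟩ := hs
  obtain ⟨ht1, ht2⟩ := ht
  obtain ⟨hP1, hP2⟩ := abs_le.1 hP
  have hpos : ∀ r : ℝ, -1 < r → r < 1 → 0 < r * P + 1 := by
    intro r h1 h2
    have h3 : |r * P| < 1 := by
      rw [abs_mul]
      have : |r| < 1 := abs_lt.2 ⟨h1, h2⟩
      calc |r| * |P| ≤ |r| * 1 := by gcongr
        _ < 1 := by linarith
    linarith [(abs_lt.1 h3).1]
  have hA : 0 < s * P + 1 := hpos s hs1 hs2
  have hT : 0 < t * P + 1 := hpos t ht1 ht2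
  set X := (1 + t) * (1 - s) with hX
  set Y := (1 - t) * (1 + s) with hY
  have hX0 : 0 < X := mul_pos (by linarith) (by linarith)
  have hY0 : 0 < Y := mul_pos (by linarith) (by linarith)
  have hXY1 : |X - Y| ≤ (E - 1) * X := by
    have : 0 ≤ E - 1 := by
      by_contra h
      push Not at h
      nlinarith
    rw [abs_le]; constructor <;> nlinarith
  have hXY2 : |X - Y| ≤ (E - 1) * Y := by
    have : 0 ≤ E - 1 := by
      by_contra h
      push Not at h
      nlinarith
    rw [abs_le]; constructor <;> nlinarith
  have hb : |τ * (X - Y)| < X := by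
    rw [abs_mul]
    calc |τ| * |X - Y| ≤ |τ| * ((E - 1) * X) := by gcongr
      _ = (|τ| * (E - 1)) * X := by ring
      _ < 1 * X := by gcongr
      _ = X := one_mul _
  have hb' : |τ * (X - Y)| < Y := by
    rw [abs_mul]
    calc |τ| * |X - Y| ≤ |τ| * ((E - 1) * Y) := by gcongr
      _ = (|τ| * (E - 1)) * Y := by ring
      _ < 1 * Y := by gcongr
      _ = Y := one_mul _
  have hp1 : 0 < X - τ * (X - Y) := by linarith [(abs_lt.1 hb).2]
  have hp2 : 0 < Y + τ * (X - Y) := by linarith [(abs_lt.1 hb').1]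
  have pos_comb : ∀ x y : ℝ, 0 < x → 0 < y → 0 < (1 + P) * x + (1 - P) * y := by
    intro x y hx hy
    rcases le_total 0 P with h | h
    · have := mul_pos (show 0 < 1 + P by linarith) hx
      have := mul_nonneg (show 0 ≤ 1 - P by linarith) hy.le
      linarith
    · have := mul_nonneg (show 0 ≤ 1 + P by linarith) hx.le
      have := mul_pos (show 0 < 1 - P by linarith) hy
      linarith
  have hn1 := pos_comb _ ((1 - t) * (1 - s)) hp1 (mul_pos (by linarith) (by linarith))
  have hn2 := pos_comb ((1 + t) * (1 + s)) _ (mul_pos (by linarith) (by linarith)) hp2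
  set D := (t * P + 1) - τ * (t - s) * P with hD
  set N := s * (t * P + 1) + τ * (t - s) with hN
  have hm1 : 0 < D - N := by
    have : 2 * (D - N) = (1 + P) * (X - τ * (X - Y)) + (1 - P) * ((1 - t) * (1 - s)) := by
      simp only [hD, hN, hX, hY]; ring
    linarith
  have hm2 : 0 < D + N := by
    have : 2 * (D + N) = (1 + P) * ((1 + t) * (1 + s)) + (1 - P) * (Y + τ * (X - Y)) := by
      simp only [hD, hN, hX, hY]; ring
    linarith
  have hD0 : 0 < D := by linarith
  have key : N / D * P + 1 = (t * P + 1) * (s * P + 1) / D := by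
    field_simp
    simp only [hD, hN]; ring
  refine ⟨N / D, ⟨?_, ?_⟩, ?_, ?_, ?_⟩
  · rw [lt_div_iff₀ hD0]; linarith
  · rw [div_lt_iff₀ hD0]; linarith
  · rw [key]; positivity
  · rw [key, inv_div, hD]
    have hA' := hA.ne'
    have hT' := hT.ne'
    rw [div_eq_iff (mul_ne_zero hT' hA')]
    linear_combination (-((t * P + 1) * (1 - τ))) * inv_mul_cancel₀ hA' -
      (τ * (s * P + 1)) * inv_mul_cancel₀ hT'
  · have hA' := hA.ne'
    have hT' := hT.ne'
    rw [key, inv_div, div_mul_div_cancel₀' hD0.ne', div_eq_iff (mul_ne_zero hT' hA'), hN]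
    linear_combination (-((t * P + 1) * (1 - τ) * s)) * inv_mul_cancel₀ hA' -
      (τ * (s * P + 1) * t) * inv_mul_cancel₀ hT'

lemma dHyp_bounds {s t c : ℝ} (hs : s ∈ II) (ht : t ∈ II) (h : dHyp s t ≤ c) :
    (1 + t) * (1 - s) ≤ Real.exp c * ((1 - t) * (1 + s)) ∧
    (1 - t) * (1 + s) ≤ Real.exp c * ((1 + t) * (1 - s)) := by
  obtain ⟨hs1, hs2⟩ := hs
  obtain ⟨ht1, ht2⟩ := ht
  unfold dHyp at h
  have hX0 : 0 < (1 + t) * (1 - s) := mul_pos (by linarith) (by linarith)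
  have hY0 : 0 < (1 - t) * (1 + s) := mul_pos (by linarith) (by linarith)
  obtain ⟨h1, h2⟩ := abs_le.1 h
  constructor
  · rw [Real.log_le_iff_le_exp (div_pos hX0 hY0), div_le_iff₀ hY0] at h2
    exact h2
  · have h3 : Real.log ((1 - t) * (1 + s) / ((1 + t) * (1 - s))) ≤ c := by
      rw [← inv_div, Real.log_inv]; linarith
    rw [Real.log_le_iff_le_exp (div_pos hY0 hX0), div_le_iff₀ hX0] at h3
    exact h3

lemma Step.seg {Ω : Set (ℙ ℝ (Fin (p + q + 2) → ℝ))} {e : Fin (p + q + 2) → ℝ}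
    (hΩ : ∀ x ∈ Ω, bForm p q e x.rep ≠ 0) {x y c} (h : Step Ω x y c) :
    bForm p q (sig e x) (sig e y) = 0 ∧
    ∀ τ : ℝ, |τ| * (Real.exp c - 1) < 1 →
      ∃ h, Projectivization.mk ℝ (sig e x + τ • (sig e y - sig e x)) h ∈ Ω := by
  obtain ⟨α, s, t, ⟨u, w, a, b, c', d, hli, huu, huw, hww, hdet, hα⟩, hs, ht, rfl, rfl, hd⟩ := h
  obtain ⟨h1, h2⟩ := dHyp_bounds hs ht hd
  set pp := a • u + c' • w with hpp
  set rr := b • u + d • w with hrr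
  have hvec : ∀ t : ℝ, (a * t + b) • u + (c' * t + d) • w = t • pp + rr := by
    intro t; simp only [hpp, hrr]; module
  have hne : ∀ t ∈ II, t * bForm p q e pp + bForm p q e rr ≠ 0 := by
    intro t ht
    obtain ⟨h0, h1, h2⟩ := hα t ht
    have h3 := hΩ _ h2
    obtain ⟨l, hl, hl2⟩ := rep_mk_smul _ h0
    rw [h1, hl2, hvec, bForm_smul_right, bForm_add_right, bForm_smul_right] at h3
    exact right_ne_zero_of_mul h3
  have hR : bForm p q e rr ≠ 0 := by
    have := hne 0 ⟨by norm_num, by norm_num⟩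
    simpa using this
  set R := bForm p q e rr with hRdef
  set P := bForm p q e pp / R with hPdef
  have hPR : bForm p q e pp = P * R := by rw [hPdef]; field_simp
  have hP : |P| ≤ 1 := by
    by_contra hlt
    push Not at hlt
    have hP0 : P ≠ 0 := by rintro h; rw [h] at hlt; norm_num at hlt
    have habs : |(-1 / P)| < 1 := by
      rw [abs_div, abs_neg, abs_one, div_lt_one (by linarith)]; exact hlt
    refine hne (-1 / P) ?_ ?_
    · exact ⟨(abs_lt.1 habs).1, (abs_lt.1 habs).2⟩
    · rw [hPR]; field_simp; ring
  have hsig : ∀ t ∈ II, sig e (α t) = (t * P + 1)⁻¹ • (R⁻¹ • rr) +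
      ((t * P + 1)⁻¹ * t) • (R⁻¹ • pp) := by
    intro t ht
    obtain ⟨h0, h1, h2⟩ := hα t ht
    rw [h1, sig_mk, hvec, bForm_add_right, bForm_smul_right, hPR, ← hRdef]
    have : t * (P * R) + R = (t * P + 1) * R := by ring
    rw [this, mul_inv]
    module
  constructor
  · rw [hsig s hs, hsig t ht]
    have hwu : bForm p q w u = 0 := by rw [bForm_comm, huw]
    simp only [hpp, hrr, bForm_add_left, bForm_add_right, bForm_smul_left, bForm_smul_right,
      huu, huw, hww, hwu]
    ring
  · intro τ hτ
    obtain ⟨v, hv, hv0, hv1, hv2⟩ := scal_aux hs ht hP h1 h2 hτ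
    have hmem := (hα v hv).2.2
    have e1 : sig e (α s) + τ • (sig e (α t) - sig e (α s)) = sig e (α v) := by
      rw [hsig s hs, hsig t ht, hsig v hv, hv2, hv1]; module
    have hb := hΩ _ hmem
    have hnz : sig e (α v) ≠ 0 := ne_zero_of_bForm (bForm_sig hb)
    refine ⟨by rw [e1]; exact hnz, ?_⟩
    simp only [e1]
    rw [mk_sig hb]; exact hmem

lemma Step.lip {Ω : Set (ℙ ℝ (Fin (p + q + 2) → ℝ))} {e : Fin (p + q + 2) → ℝ}
    (hΩ : ∀ x ∈ Ω, bForm p q e x.rep ≠ 0) {D : ℝ} (hD0 : 0 < D) (hD : ∀ x ∈ Ω, ‖sig e x‖ ≤ D)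
    {x y c} (h : Step Ω x y c) (hc0 : 0 ≤ c) (hc1 : c ≤ 1) :
    ‖sig e x - sig e y‖ ≤ 8 * D * c := by
  by_contra hlt
  push Not at hlt
  rw [norm_sub_rev] at hlt
  set n := ‖sig e y - sig e x‖ with hn
  have hn0 : 0 < n := lt_of_le_of_lt (by positivity) hlt
  have hx := (h.mem).1
  obtain ⟨horth, hseg⟩ := h.seg hΩ
  have hexp : Real.exp c - 1 ≤ 2 * c := by
    have := Real.abs_exp_sub_one_le (x := c) (by rw [abs_of_nonneg hc0]; exact hc1)
    rw [abs_of_nonneg hc0] at this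
    exact (le_abs_self _).trans this
  have hτ : |4 * D / n| * (Real.exp c - 1) < 1 := by
    rw [abs_of_pos (by positivity)]
    calc 4 * D / n * (Real.exp c - 1) ≤ 4 * D / n * (2 * c) := by gcongr
      _ = 8 * D * c / n := by ring
      _ < 1 := by rw [div_lt_one hn0]; exact hlt
  obtain ⟨hne, hm⟩ := hseg _ hτ
  have hone : bForm p q e (sig e x + (4 * D / n) • (sig e y - sig e x)) = 1 := by
    rw [bForm_add_right, bForm_smul_right, bForm_sub_right, bForm_sig (hΩ _ hx),
      bForm_sig (hΩ _ h.mem.2)]; ring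
  have h1 := hD _ hm
  rw [sig_mk_of_one hone] at h1
  have h2 := hD _ hx
  have h3 : ‖(4 * D / n) • (sig e y - sig e x)‖ = 4 * D := by
    rw [norm_smul, ← hn, Real.norm_of_nonneg (by positivity)]; field_simp
  have h4 : ‖(4 * D / n) • (sig e y - sig e x)‖ ≤
      ‖sig e x + (4 * D / n) • (sig e y - sig e x)‖ + ‖sig e x‖ := by
    have := norm_sub_le (sig e x + (4 * D / n) • (sig e y - sig e x)) (sig e x)
    simpa using this
  linarith

lemma Ch.lip {Ω : Set (ℙ ℝ (Fin (p + q + 2) → ℝ))} {e : Fin (p + q + 2) → ℝ}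
    (hΩ : ∀ x ∈ Ω, bForm p q e x.rep ≠ 0) {D : ℝ} (hD0 : 0 < D) (hD : ∀ x ∈ Ω, ‖sig e x‖ ≤ D)
    {x y c} (h : Ch Ω x y c) : c ≤ 1 → ‖sig e x - sig e y‖ ≤ 8 * D * c := by
  induction h with
  | nil => intro; simp
  | cons x y z c d h1 h2 h3 ih =>
    intro hcd
    have hd := h3.nonneg
    have g1 := h1.lip hΩ hD0 hD h2 (by linarith)
    have g2 := ih (by linarith)
    have := norm_sub_le_norm_sub_add_norm_sub (sig e x) (sig e y) (sig e z)
    linarith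

lemma claimA {Ω : Set (ℙ ℝ (Fin (p + q + 2) → ℝ))} {e : Fin (p + q + 2) → ℝ}
    (hcl : ∀ x ∈ closure Ω, bForm p q e x.rep ≠ 0) {D : ℝ} (hD : ∀ x ∈ Ω, ‖sig e x‖ ≤ D)
    (hein : Ω ⊆ einSet (bForm p q)) {a : ℙ ℝ (Fin (p + q + 2) → ℝ)}
    (ha : IsPhotonExtremal (bForm p q) Ω a)
    {xs ys : ℕ → ℙ ℝ (Fin (p + q + 2) → ℝ)}
    (hxs : ∀ k, xs k ∈ Ω) (hys : ∀ k, ys k ∈ Ω)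
    (hxa : Tendsto xs atTop (𝓝 a)) (C : ℝ)
    (h : ∀ k, xs k = ys k ∨ Step Ω (xs k) (ys k) C) :
    Tendsto ys atTop (𝓝 a) := by
  have hΩ : ∀ x ∈ Ω, bForm p q e x.rep ≠ 0 := fun x hx => hcl x (subset_closure hx)
  have hae := hcl a ha.1.1
  have hnull : ∀ x ∈ Ω, bForm p q (sig e x) (sig e x) = 0 := by
    intro x hx
    have := hein hx
    simp only [einSet, Set.mem_ofPred_eq] at this
    unfold sig
    rw [bForm_smul_left, bForm_smul_right, this]; simp
  -- the segment property
  have hseg : ∀ k, bForm p q (sig e (xs k)) (sig e (ys k)) = 0 ∧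
      ∀ τ : ℝ, |τ| < Real.exp (-C) →
      ∃ h, Projectivization.mk ℝ (sig e (xs k) + τ • (sig e (ys k) - sig e (xs k))) h ∈ Ω := by
    intro k
    rcases h k with h | h
    · rw [← h]
      refine ⟨hnull _ (hxs k), fun τ _ => ?_⟩
      have hb := hΩ _ (hxs k)
      refine ⟨by simpa using ne_zero_of_bForm (bForm_sig hb), ?_⟩
      simp only [sub_self, smul_zero, add_zero]
      rw [mk_sig hb]; exact hxs k
    · obtain ⟨h1, h2⟩ := h.seg hΩ
      refine ⟨h1, fun τ hτ => h2 τ ?_⟩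
      have := Real.exp_pos C
      calc |τ| * (Real.exp C - 1) ≤ |τ| * Real.exp C := by gcongr; linarith
        _ < Real.exp (-C) * Real.exp C := by gcongr
        _ = 1 := by rw [← Real.exp_add]; simp
  have hsx : Tendsto (fun k => sig e (xs k)) atTop (𝓝 (sig e a)) :=
    (sig_continuousAt e a hae).tendsto.comp hxa
  have main : Tendsto (fun k => sig e (ys k)) atTop (𝓝 (sig e a)) := by
    refine tendsto_of_subseq_tendsto fun ns hns => ?_
    obtain ⟨z, -, φ, hφ, hz⟩ := (isCompact_closedBall (0 : Fin (p + q + 2) → ℝ) D).tendsto_subseq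
      (x := fun k => sig e (ys (ns k)))
      (fun k => by simpa using hD _ (hys (ns k)))
    refine ⟨φ, ?_⟩
    suffices hza : z = sig e a by rw [← hza]; exact hz
    by_contra hza
    have hx' : Tendsto (fun k => sig e (xs (ns (φ k)))) atTop (𝓝 (sig e a)) :=
      hsx.comp (hns.comp hφ.tendsto_atTop)
    have hy' : Tendsto (fun k => sig e (ys (ns (φ k)))) atTop (𝓝 z) := hz
    have h1a : bForm p q e (sig e a) = 1 := bForm_sig hae
    have h1z : bForm p q e z = 1 := by
      have := bForm_tendsto (tendsto_const_nhds (x := e)) hy'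
      refine tendsto_nhds_unique this ?_
      simp only [bForm_sig (hΩ _ (hys _))]; exact tendsto_const_nhds
    have haa : bForm p q (sig e a) (sig e a) = 0 := by
      refine tendsto_nhds_unique (bForm_tendsto hx' hx') ?_
      simp only [hnull _ (hxs _)]; exact tendsto_const_nhds
    have hzz : bForm p q z z = 0 := by
      refine tendsto_nhds_unique (bForm_tendsto hy' hy') ?_
      simp only [hnull _ (hys _)]; exact tendsto_const_nhds
    have haz : bForm p q (sig e a) z = 0 := by
      refine tendsto_nhds_unique (bForm_tendsto hx' hy') ?_
      simp only [(hseg _).1]; exact tendsto_const_nhds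
    have hza' : bForm p q z (sig e a) = 0 := by rw [bForm_comm, haz]
    have hli : LinearIndependent ℝ ![sig e a, z] := by
      rw [LinearIndependent.pair_iff]
      intro s t hst
      have h1 : s + t = 0 := by
        have := congrArg (bForm p q e) hst
        rw [bForm_add_right, bForm_smul_right, bForm_smul_right, h1a, h1z, bForm_zero_right] at this
        linarith
      have h2 : t • (z - sig e a) = 0 := by
        have hs : s = -t := by linarith
        rw [hs] at hst
        rw [← hst]; module
      rcases smul_eq_zero.1 h2 with h3 | h3
      · exact ⟨by linarith, h3⟩
      · exact absurd (sub_eq_zero.1 h3) hza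
    refine ha.2 (Submodule.span ℝ {sig e a, z}) ⟨?_, ?_⟩ ?_ ?_
    · have := finrank_span_eq_card hli
      have e2 : Set.range ![sig e a, z] = {sig e a, z} := by
        simp [Matrix.range_cons, Matrix.range_empty, Set.pair_comm]
      rw [e2] at this
      simpa using this
    · intro u hu w hw
      obtain ⟨s, t, rfl⟩ := Submodule.mem_span_pair.1 hu
      obtain ⟨s', t', rfl⟩ := Submodule.mem_span_pair.1 hw
      simp only [bForm_add_left, bForm_add_right, bForm_smul_left, bForm_smul_right,
        haa, haz, hza', hzz]
      ring
    · have : a.rep = (bForm p q e a.rep) • sig e a := by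
        unfold sig; rw [smul_smul, mul_inv_cancel₀ hae, one_smul]
      rw [this]
      exact Submodule.smul_mem _ _ (Submodule.subset_span (by simp))
    · have hpos : 0 < ‖z - sig e a‖ := norm_pos_iff.2 (sub_ne_zero.2 hza)
      have hcont := sig_continuousAt e a hae
      have hev1 : ∀ᶠ y in 𝓝 a, ‖sig e y - sig e a‖ < Real.exp (-C) * ‖z - sig e a‖ := by
        have := hcont.tendsto.eventually (Metric.ball_mem_nhds (sig e a)
          (mul_pos (Real.exp_pos (-C)) hpos))
        filter_upwards [this] with y hy
        rwa [dist_eq_norm] at hy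
      have hev2 : ∀ᶠ y in 𝓝 a, bForm p q e (sig e y) ≠ 0 := by
        have h3 : Tendsto (fun y => bForm p q e (sig e y)) (𝓝 a) (𝓝 1) := by
          rw [← h1a]; exact bForm_tendsto tendsto_const_nhds hcont.tendsto
        exact h3.eventually_ne one_ne_zero
      obtain ⟨U, hU, hUo, haU⟩ := eventually_nhds_iff.1 (hev1.and hev2)
      refine ⟨U, hUo, haU, ?_⟩
      rintro y ⟨hyU, hyP⟩
      obtain ⟨hy1, hy2⟩ := hU y hyU
      have hye : bForm p q e y.rep ≠ 0 := by
        intro h0; apply hy2; unfold sig; rw [h0]; simp [bForm_zero_right]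
      have hys1 := bForm_sig hye
      have hymem : sig e y ∈ Submodule.span ℝ {sig e a, z} := Submodule.smul_mem _ _ hyP
      obtain ⟨s, t, hst⟩ := Submodule.mem_span_pair.1 hymem
      have hst1 : s + t = 1 := by
        rw [← hst, bForm_add_right, bForm_smul_right, bForm_smul_right, h1a, h1z] at hys1
        linarith
      have hyt : sig e y = sig e a + t • (z - sig e a) := by
        have : s = 1 - t := by linarith
        rw [← hst, this]; module
      have ht : |t| < Real.exp (-C) := by
        rw [hyt, add_sub_cancel_left, norm_smul, Real.norm_eq_abs] at hy1
        exact lt_of_mul_lt_mul_right hy1 hpos.le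
      have hlim : Tendsto (fun k => sig e (xs (ns (φ k))) +
          t • (sig e (ys (ns (φ k))) - sig e (xs (ns (φ k))))) atTop (𝓝 (sig e y)) := by
        rw [hyt]; exact hx'.add ((hy'.sub hx').const_smul t)
      have hyn : sig e y ≠ 0 := ne_zero_of_bForm hys1
      have := tendsto_mk hlim (fun k => ((hseg _).2 t ht).1) hyn
      rw [mk_sig hye] at this
      exact mem_closure_of_tendsto this (Eventually.of_forall fun k => ((hseg _).2 t ht).2)
  have hn : ∀ k, sig e (ys k) ≠ 0 := fun k => ne_zero_of_bForm (bForm_sig (hΩ _ (hys k)))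
  have han : sig e a ≠ 0 := ne_zero_of_bForm (bForm_sig hae)
  have := tendsto_mk main hn han
  rw [mk_sig hae] at this
  refine this.congr fun k => mk_sig (hΩ _ (hys k)) _

/-- The sign involution. -/
def Jm (p q : ℕ) : (Fin (p + q + 2) → ℝ) →ₗ[ℝ] (Fin (p + q + 2) → ℝ) where
  toFun v := fun i => (if (i : ℕ) ≤ p then (-1 : ℝ) else 1) * v i
  map_add' u v := by funext i; simp only [Pi.add_apply]; ring
  map_smul' c v := by funext i; simp only [Pi.smul_apply, smul_eq_mul, RingHom.id_apply]; ring

lemma bForm_eq_J_left (v w : Fin (p + q + 2) → ℝ) : bForm p q v w = Jm p q v ⬝ᵥ w := rfl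

lemma bForm_eq_J_right (v w : Fin (p + q + 2) → ℝ) : bForm p q v w = v ⬝ᵥ Jm p q w := by
  rw [bForm_comm, bForm_eq_J_left, dotProduct_comm]

lemma Jm_Jm (v : Fin (p + q + 2) → ℝ) : Jm p q (Jm p q v) = v := by
  funext i; simp only [Jm, LinearMap.coe_mk, AddHom.coe_mk]; split_ifs <;> ring

lemma null_combo {X Y : Fin (p + q + 2) → ℝ} (hX : Jm p q X = -X) (hY : Jm p q Y = Y)
    (h : X ⬝ᵥ X = Y ⬝ᵥ Y) : bForm p q (X + Y) (X + Y) = 0 := by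
  rw [bForm_eq_J_left, map_add, hX, hY]
  simp only [dotProduct_add, add_dotProduct, neg_dotProduct]
  have := dotProduct_comm X Y
  linarith

lemma exists_rot (x y : ℝ) : ∃ c s : ℝ, c * c + s * s = 1 ∧ x * c + y * s = 0 := by
  by_cases h : x ^ 2 + y ^ 2 = 0
  · have hx : x = 0 := by nlinarith [sq_nonneg x, sq_nonneg y]
    have hy : y = 0 := by nlinarith [sq_nonneg x, sq_nonneg y]
    exact ⟨1, 0, by norm_num, by simp [hx, hy]⟩
  · have hpos : 0 < x ^ 2 + y ^ 2 := lt_of_le_of_ne (by positivity) (Ne.symm h)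
    have hs := Real.sq_sqrt hpos.le
    have hs0 : Real.sqrt (x ^ 2 + y ^ 2) ≠ 0 := (Real.sqrt_pos.2 hpos).ne'
    refine ⟨y / Real.sqrt (x ^ 2 + y ^ 2), -x / Real.sqrt (x ^ 2 + y ^ 2), ?_, ?_⟩
    · field_simp; rw [hs]; ring
    · field_simp; ring

lemma exists_unit (e : Fin (p + q + 2) → ℝ) (i j : Fin (p + q + 2)) (hij : i ≠ j) :
    ∃ c s : ℝ, (Pi.single i c + Pi.single j s : Fin (p + q + 2) → ℝ) ⬝ᵥ
      (Pi.single i c + Pi.single j s) = 1 ∧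
      e ⬝ᵥ (Pi.single i c + Pi.single j s : Fin (p + q + 2) → ℝ) = 0 := by
  obtain ⟨c, s, h1, h2⟩ := exists_rot (e i) (e j)
  refine ⟨c, s, ?_, ?_⟩
  · simp [dotProduct_add, dotProduct_single, hij, hij.symm]; linarith
  · simp [dotProduct_add, dotProduct_single]; linarith

lemma exists_EF (hp : 1 ≤ p) (hq : 1 ≤ q) (e : Fin (p + q + 2) → ℝ) :
    ∃ E F : Fin (p + q + 2) → ℝ, Jm p q E = E ∧ Jm p q F = -F ∧ E ⬝ᵥ E = 1 ∧ F ⬝ᵥ F = 1 ∧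
      e ⬝ᵥ E = 0 ∧ e ⬝ᵥ F = 0 := by
  obtain ⟨c, s, h1, h2⟩ := exists_unit e (⟨p + 1, by omega⟩ : Fin (p + q + 2))
    ⟨p + 2, by omega⟩ (by simp)
  obtain ⟨c', s', h1', h2'⟩ := exists_unit e (⟨0, by omega⟩ : Fin (p + q + 2))
    ⟨1, by omega⟩ (by simp)
  refine ⟨_, _, ?_, ?_, h1, h1', h2, h2'⟩
  · funext i
    simp only [Jm, LinearMap.coe_mk, AddHom.coe_mk, Pi.add_apply, Pi.single_apply, Fin.ext_iff]
    split_ifs <;> first | omega | simp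
  · funext i
    simp only [Jm, LinearMap.coe_mk, AddHom.coe_mk, Pi.add_apply, Pi.single_apply, Fin.ext_iff,
      Pi.neg_apply]
    split_ifs <;> first | omega | simp

lemma exists_decomp (hp : 1 ≤ p) (hq : 1 ≤ q) (e : Fin (p + q + 2) → ℝ) :
    ∃ n : Fin 3 → (Fin (p + q + 2) → ℝ) → (Fin (p + q + 2) → ℝ),
      (∀ i, Continuous (n i)) ∧ (∀ i, n i 0 = 0) ∧
      ∀ v, bForm p q e v = 0 → e ⬝ᵥ v = 0 →
        v = n 0 v + n 1 v + n 2 v ∧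
        ∀ i, bForm p q (n i v) (n i v) = 0 ∧ bForm p q e (n i v) = 0 ∧ e ⬝ᵥ n i v = 0 := by
  obtain ⟨E, F, hE, hF, hEE, hFF, heE, heF⟩ := exists_EF hp hq e
  have hJc : Continuous (Jm p q) := LinearMap.continuous_of_finiteDimensional _
  let vm : (Fin (p + q + 2) → ℝ) → (Fin (p + q + 2) → ℝ) := fun v => (1 / 2 : ℝ) • (v - Jm p q v)
  let N : (Fin (p + q + 2) → ℝ) → ℝ := fun v => Real.sqrt (v ⬝ᵥ v)
  let w : (Fin (p + q + 2) → ℝ) → (Fin (p + q + 2) → ℝ) := fun v =>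
    (1 / 2 : ℝ) • (v + Jm p q v) - N (vm v) • E
  have hvmc : Continuous vm := by fun_prop
  have hNc : Continuous N := by
    refine Real.continuous_sqrt.comp ?_
    unfold dotProduct; fun_prop
  have hwc : Continuous w := by fun_prop
  have hN0 : N 0 = 0 := by simp [N]
  have hvm0 : vm 0 = 0 := by simp [vm]
  have hw0 : w 0 = 0 := by simp [w, hvm0, hN0]
  have hNN : ∀ v, N v * N v = v ⬝ᵥ v := fun v => Real.mul_self_sqrt (by
    unfold dotProduct; exact Finset.sum_nonneg fun i _ => mul_self_nonneg _)
  have hJvm : ∀ v, Jm p q (vm v) = - vm v := by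
    intro v; simp only [vm, map_smul, map_sub, Jm_Jm]; module
  have hJw : ∀ v, Jm p q (w v) = w v := by
    intro v; simp only [w, map_smul, map_sub, map_add, Jm_Jm, hE]; module
  refine ⟨![fun v => vm v + N (vm v) • E, fun v => (N (w v) / 2) • F + (1 / 2 : ℝ) • w v,
    fun v => (-(N (w v) / 2)) • F + (1 / 2 : ℝ) • w v], ?_, ?_, ?_⟩
  · intro i; fin_cases i
    · change Continuous fun v => vm v + N (vm v) • E
      fun_prop
    · change Continuous fun v => (N (w v) / 2) • F + (1 / 2 : ℝ) • w v
      fun_prop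
    · change Continuous fun v => (-(N (w v) / 2)) • F + (1 / 2 : ℝ) • w v
      fun_prop
  · intro i; fin_cases i
    · simp [hvm0, hN0]
    · simp [hw0, hN0]
    · simp [hw0, hN0]
  · intro v hv1 hv2
    have hvJ : e ⬝ᵥ Jm p q v = 0 := by rw [← bForm_eq_J_right, hv1]
    have hevm : e ⬝ᵥ vm v = 0 := by
      simp only [vm, dotProduct_smul, dotProduct_sub, hvJ, hv2]; simp
    have hew : e ⬝ᵥ w v = 0 := by
      simp only [w, dotProduct_smul, dotProduct_sub, dotProduct_add, hvJ, hv2, heE]; simp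
    refine ⟨?_, ?_⟩
    · change v = (vm v + N (vm v) • E) + ((N (w v) / 2) • F + (1 / 2 : ℝ) • w v) +
        ((-(N (w v) / 2)) • F + (1 / 2 : ℝ) • w v)
      have : w v = (1 / 2 : ℝ) • (v + Jm p q v) - N (vm v) • E := rfl
      have h2 : v = vm v + N (vm v) • E + w v := by
        rw [this]; simp only [vm]; module
      conv_lhs => rw [h2]
      module
    · have gen : ∀ X Y : Fin (p + q + 2) → ℝ, Jm p q X = -X → Jm p q Y = Y →
          X ⬝ᵥ X = Y ⬝ᵥ Y → e ⬝ᵥ X = 0 → e ⬝ᵥ Y = 0 →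
          bForm p q (X + Y) (X + Y) = 0 ∧ bForm p q e (X + Y) = 0 ∧ e ⬝ᵥ (X + Y) = 0 := by
        intro X Y hX hY hXY heX heY
        refine ⟨null_combo hX hY hXY, ?_, ?_⟩
        · rw [bForm_eq_J_right, map_add, hX, hY, dotProduct_add, dotProduct_neg, heX, heY]; simp
        · rw [dotProduct_add, heX, heY]; simp
      have hsq : ∀ (r : ℝ) (X : Fin (p + q + 2) → ℝ), X ⬝ᵥ X = 1 → (r • X) ⬝ᵥ (r • X) = r * r := by
        intro r X hX
        simp only [dotProduct_smul, smul_dotProduct, hX, smul_eq_mul, mul_one]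
      have hhalf : ∀ (X : Fin (p + q + 2) → ℝ),
          ((1 / 2 : ℝ) • X) ⬝ᵥ ((1 / 2 : ℝ) • X) = (1 / 4) * (X ⬝ᵥ X) := by
        intro X
        simp only [dotProduct_smul, smul_dotProduct, smul_eq_mul]; ring
      intro i; fin_cases i
      · refine gen (vm v) (N (vm v) • E) (hJvm v) (by rw [map_smul, hE]) ?_ hevm ?_
        · have h := hsq (N (vm v)) E hEE
          rw [h]; exact (hNN (vm v)).symm
        · rw [dotProduct_smul, heE]; simp
      · refine gen ((N (w v) / 2) • F) ((1 / 2 : ℝ) • w v) (by rw [map_smul, hF]; module)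
          (by rw [map_smul, hJw]) ?_ ?_ ?_
        · have h := hsq (N (w v) / 2) F hFF
          have h2 := hhalf (w v)
          have h3 := hNN (w v)
          rw [h, h2, ← h3]; ring
        · rw [dotProduct_smul, heF]; simp
        · rw [dotProduct_smul, hew]; simp
      · refine gen ((-(N (w v) / 2)) • F) ((1 / 2 : ℝ) • w v) (by rw [map_smul, hF]; module)
          (by rw [map_smul, hJw]) ?_ ?_ ?_
        · have h := hsq (-(N (w v) / 2)) F hFF
          have h2 := hhalf (w v)
          have h3 := hNN (w v)
          rw [h, h2, ← h3]; ring
        · rw [dotProduct_smul, heF]; simp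
        · rw [dotProduct_smul, hew]; simp

/-- Trivial or a single segment. -/
def Seg (Ω : Set (ℙ ℝ (Fin (p + q + 2) → ℝ))) (x y : ℙ ℝ (Fin (p + q + 2) → ℝ)) : Prop :=
  x = y ∨ Step Ω x y (Real.log 3)

/-- The flat chart. -/
def psi (e f h : Fin (p + q + 2) → ℝ) : Fin (p + q + 2) → ℝ :=
  f + h - (bForm p q h h / 2) • e

lemma psi_facts {e f h : Fin (p + q + 2) → ℝ} (hee : bForm p q e e = 0) (hff : bForm p q f f = 0)
    (hef : bForm p q e f = 1) (heh : bForm p q e h = 0) (hfh : bForm p q f h = 0) :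
    bForm p q e (psi e f h) = 1 ∧ bForm p q (psi e f h) (psi e f h) = 0 := by
  have hfe : bForm p q f e = 1 := by rw [bForm_comm, hef]
  have hhe : bForm p q h e = 0 := by rw [bForm_comm, heh]
  have hhf : bForm p q h f = 0 := by rw [bForm_comm, hfh]
  unfold psi
  simp only [bForm_add_left, bForm_add_right, bForm_smul_left, bForm_smul_right, bForm_sub_left,
    bForm_sub_right, hee, hff, hef, heh, hfh, hfe, hhe, hhf]
  constructor <;> ring

lemma seg_aux {Ω : Set (ℙ ℝ (Fin (p + q + 2) → ℝ))}
    {e f h n : Fin (p + q + 2) → ℝ} (hee : bForm p q e e = 0) (hff : bForm p q f f = 0)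
    (hef : bForm p q e f = 1) (heh : bForm p q e h = 0) (hfh : bForm p q f h = 0)
    (hen : bForm p q e n = 0) (hfn : bForm p q f n = 0) (hnn : bForm p q n n = 0)
    (hmem : ∀ t : ℝ, |t| < 2 → ∃ hne, Projectivization.mk ℝ (psi e f (h + t • n)) hne ∈ Ω)
    (h1 : psi e f h ≠ 0) (h2 : psi e f (h + n) ≠ 0) :
    Seg Ω (Projectivization.mk ℝ (psi e f h) h1) (Projectivization.mk ℝ (psi e f (h + n)) h2) := by
  obtain ⟨g1, g2⟩ := psi_facts hee hff hef heh hfh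
  set m := n - (bForm p q h n) • e with hm
  have hline : ∀ t : ℝ, psi e f (h + t • n) = psi e f h + t • m := by
    intro t
    unfold psi
    rw [bForm_add_left, bForm_add_right, bForm_add_right, bForm_smul_left, bForm_smul_left,
      bForm_smul_right, bForm_smul_right, hnn, bForm_comm n h, hm]
    module
  have hline1 : psi e f (h + n) = psi e f h + m := by
    have := hline 1
    simpa using this
  by_cases hm0 : m = 0
  · left
    rw [hm0, add_zero] at hline1
    simp only [hline1]
  · right
    have hem : bForm p q e m = 0 := by
      rw [hm, bForm_sub_right, bForm_smul_right, hee, hen]; ring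
    refine ⟨fun t => if ht : |2 * t| < 2 then
      Projectivization.mk ℝ _ (hmem (2 * t) ht).1 else Projectivization.mk ℝ _ h1, 0, 1 / 2,
      ⟨psi e f h, m, 0, 1, 2, 0, ?_, g2, ?_, ?_, by norm_num, ?_⟩, ?_, ?_, ?_, ?_, ?_⟩
    · rw [LinearIndependent.pair_iff]
      intro s t hst
      have hs : s = 0 := by
        have := congrArg (bForm p q e) hst
        rw [bForm_add_right, bForm_smul_right, bForm_smul_right, g1, hem, bForm_zero_right] at this
        linarith
      refine ⟨hs, ?_⟩
      rw [hs, zero_smul, zero_add] at hst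
      exact (smul_eq_zero.1 hst).resolve_right hm0
    · rw [hm]
      have hhe : bForm p q h e = 0 := by rw [bForm_comm, heh]
      have hfe : bForm p q f e = 1 := by rw [bForm_comm, hef]
      unfold psi
      simp only [bForm_add_left, bForm_smul_left, bForm_smul_right, bForm_sub_left,
        bForm_sub_right, hee, hen, hfn, hfe, hhe]
      ring
    · rw [hm]
      have hne' : bForm p q n e = 0 := by rw [bForm_comm, hen]
      simp only [bForm_smul_left, bForm_smul_right, bForm_sub_left,
        bForm_sub_right, hee, hen, hnn, hne']
      ring
    · intro t ht
      have ht' : |2 * t| < 2 := by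
        rw [abs_lt]; obtain ⟨h1, h2⟩ := ht; constructor <;> linarith
      have hv : ((0 : ℝ) * t + 1) • psi e f h + (2 * t + 0) • m = psi e f (h + (2 * t) • n) := by
        rw [hline]; module
      obtain ⟨hne, hM⟩ := hmem (2 * t) ht'
      refine ⟨by rw [hv]; exact hne, ?_, ?_⟩
      · simp only [dif_pos ht', hv]
      · simp only [dif_pos ht']; exact hM
    · constructor <;> norm_num
    · constructor <;> norm_num
    · simp
    · have : |2 * (1 / 2 : ℝ)| < 2 := by norm_num
      simp only [dif_pos this]
      norm_num
    · unfold dHyp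
      norm_num
      rw [abs_of_nonneg (Real.log_nonneg (by norm_num))]

lemma local_conn (hp : 1 ≤ p) (hq : 1 ≤ q) {e : Fin (p + q + 2) → ℝ} (he0 : e ≠ 0)
    (hee : bForm p q e e = 0) {Ω O K : Set (ℙ ℝ (Fin (p + q + 2) → ℝ))}
    (hO : IsOpen O) (hΩO : ∀ x ∈ einSet (bForm p q), x ∈ Ω ↔ x ∈ O)
    (hein : Ω ⊆ einSet (bForm p q)) (hΩ : ∀ x ∈ Ω, bForm p q e x.rep ≠ 0)
    (hK : IsCompact K) (hKΩ : K ⊆ Ω) :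
    ∃ ρ > 0, ∀ x ∈ K, ∀ y ∈ Ω, ‖sig e x - sig e y‖ < ρ →
      ∃ z1 ∈ Ω, ∃ z2 ∈ Ω, Seg Ω x z1 ∧ Seg Ω z1 z2 ∧ Seg Ω z2 y := by
  obtain ⟨n, hnc, hn0, hn⟩ := exists_decomp hp hq e
  have hdd : 0 < e ⬝ᵥ e := by
    rw [lt_iff_le_and_ne]
    refine ⟨by unfold dotProduct; exact Finset.sum_nonneg fun i _ => mul_self_nonneg _, ?_⟩
    intro h; exact he0 (dotProduct_self_eq_zero.1 h.symm)
  set f : Fin (p + q + 2) → ℝ := (e ⬝ᵥ e)⁻¹ • Jm p q e with hf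
  have hfv : ∀ v, bForm p q f v = (e ⬝ᵥ e)⁻¹ * (e ⬝ᵥ v) := by
    intro v; rw [hf, bForm_smul_left, bForm_eq_J_left, Jm_Jm]
  have hef : bForm p q e f = 1 := by
    rw [bForm_comm, hfv, inv_mul_cancel₀ hdd.ne']
  have hfe : bForm p q f e = 1 := by rw [bForm_comm, hef]
  have hff : bForm p q f f = 0 := by
    rw [hfv, hf, dotProduct_smul, ← bForm_eq_J_right, hee]; simp
  let π : (Fin (p + q + 2) → ℝ) → (Fin (p + q + 2) → ℝ) := fun v =>
    v - (bForm p q f v) • e - (bForm p q e v) • f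
  have hπc : Continuous π := by
    have h1 : Continuous fun v : Fin (p + q + 2) → ℝ => bForm p q f v :=
      bForm_continuous' continuous_const continuous_id
    have h2 : Continuous fun v : Fin (p + q + 2) → ℝ => bForm p q e v :=
      bForm_continuous' continuous_const continuous_id
    fun_prop
  have hπe : ∀ v, bForm p q e (π v) = 0 := by
    intro v; simp only [π, bForm_sub_right, bForm_smul_right, hee, hef]; ring
  have hπf : ∀ v, bForm p q f (π v) = 0 := by
    intro v; simp only [π, bForm_sub_right, bForm_smul_right, hff, hfe]; ring
  have hπsub : ∀ u v, π (u - v) = π u - π v := by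
    intro u v; simp only [π, bForm_sub_right]; module
  have hψπ : ∀ v, bForm p q v v = 0 → bForm p q e v = 1 → psi e f (π v) = v := by
    intro v hv1 hv2
    have hQ : bForm p q (π v) (π v) = -2 * bForm p q f v := by
      have h1 : bForm p q v f = bForm p q f v := bForm_comm _ _
      have h2 : bForm p q v e = 1 := by rw [bForm_comm, hv2]
      simp only [π, bForm_sub_left, bForm_sub_right, bForm_smul_left, bForm_smul_right,
        hff, hfe, hef, hee, hv1, hv2, h1, h2]
      ring
    unfold psi
    rw [hQ]
    simp only [π, hv2]
    module
  have hψc : Continuous (psi e f) := by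
    have h1 : Continuous fun v : Fin (p + q + 2) → ℝ => bForm p q v v :=
      bForm_continuous' continuous_id continuous_id
    unfold psi
    fun_prop
  let O' : Set (Fin (p + q + 2) → ℝ) := {w | ∃ h, Projectivization.mk ℝ w h ∈ O}
  have hO' : IsOpen O' := by
    have h1 : IsOpen {v : Fin (p + q + 2) → ℝ | v ≠ 0} := isOpen_ne
    have h2 := (hO.preimage (isOpenQuotientMap_mk (p := p) (q := q)).continuous)
    have h3 := h1.isOpenMap_subtype_val _ h2
    convert h3 using 1
    ext w
    simp only [O', Set.mem_ofPred_eq, Set.mem_image, Set.mem_preimage, Subtype.exists]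
    constructor
    · rintro ⟨h, hw⟩; exact ⟨w, h, hw, rfl⟩
    · rintro ⟨w', h, hw, rfl⟩; exact ⟨h, hw⟩
  have hnull : ∀ x ∈ Ω, bForm p q (sig e x) (sig e x) = 0 := by
    intro x hx
    have := hein hx
    simp only [einSet, Set.mem_ofPred_eq] at this
    unfold sig
    rw [bForm_smul_left, bForm_smul_right, this]; simp
  have hψσ : ∀ x ∈ Ω, psi e f (π (sig e x)) = sig e x := fun x hx =>
    hψπ _ (hnull x hx) (bForm_sig (hΩ x hx))
  have hKc : IsCompact ((fun x => π (sig e x)) '' K) := by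
    refine hK.image_of_continuousOn ?_
    intro x hx
    exact (hπc.continuousAt.comp (sig_continuousAt e x (hΩ x (hKΩ hx)))).continuousWithinAt
  have hKsub : ((fun x => π (sig e x)) '' K) ⊆ psi e f ⁻¹' O' := by
    rintro _ ⟨x, hx, rfl⟩
    have hx' := hKΩ hx
    simp only [Set.mem_preimage, hψσ x hx']
    have hb := hΩ x hx'
    refine ⟨ne_zero_of_bForm (bForm_sig hb), ?_⟩
    rw [mk_sig hb]
    exact (hΩO x (hein hx')).1 hx'
  obtain ⟨δ, hδ, hthick⟩ := hKc.exists_thickening_subset_open (hO'.preimage hψc) hKsub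
  have hG : Continuous fun v => ‖n 0 (π v)‖ + ‖n 1 (π v)‖ + ‖n 2 (π v)‖ := by
    have h0 := (hnc 0).comp hπc
    have h1 := (hnc 1).comp hπc
    have h2 := (hnc 2).comp hπc
    exact (h0.norm.add h1.norm).add h2.norm
  have hπ0 : π 0 = 0 := by simp [π, bForm_zero_right]
  obtain ⟨ρ, hρ, hρG⟩ := Metric.continuousAt_iff.1 (hG.continuousAt (x := 0)) (δ / 2) (by linarith)
  refine ⟨ρ, hρ, ?_⟩
  intro x hx y hy hxy
  have hx' := hKΩ hx
  set v := sig e y - sig e x with hv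
  have hGv : ‖n 0 (π v)‖ + ‖n 1 (π v)‖ + ‖n 2 (π v)‖ < δ / 2 := by
    have := hρG (x := v) (by rw [dist_zero_right, hv, norm_sub_rev]; exact hxy)
    simp only [hπ0, hn0, norm_zero, add_zero, dist_zero_right] at this
    exact (le_abs_self _).trans_lt this
  have hπv : e ⬝ᵥ π v = 0 := by
    have := hπf v
    rw [hfv] at this
    exact (mul_eq_zero.1 this).resolve_left (inv_ne_zero hdd.ne')
  obtain ⟨hsum, hni⟩ := hn (π v) (hπe v) hπv
  have hnf : ∀ i, bForm p q f (n i (π v)) = 0 := by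
    intro i; rw [hfv, (hni i).2.2, mul_zero]
  set n0 := n 0 (π v)
  set n1 := n 1 (π v)
  set n2 := n 2 (π v)
  set h0 := π (sig e x) with hh0
  have hmem : ∀ h, bForm p q e h = 0 → bForm p q f h = 0 → ‖h - h0‖ < δ →
      ∃ hne, Projectivization.mk ℝ (psi e f h) hne ∈ Ω := by
    intro h g1 g2 g3
    have : h ∈ Metric.thickening δ ((fun x => π (sig e x)) '' K) := by
      rw [Metric.mem_thickening_iff]
      exact ⟨h0, ⟨x, hx, rfl⟩, by rw [dist_eq_norm]; exact g3⟩
    obtain ⟨hne, hm⟩ := hthick this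
    refine ⟨hne, ?_⟩
    refine (hΩO _ ?_).2 hm
    rw [mk_mem_einSet]
    exact (psi_facts hee hff hef g1 g2).2
  have hE0 : bForm p q e h0 = 0 := hπe _
  have hF0 : bForm p q f h0 = 0 := hπf _
  have hE1 : bForm p q e (h0 + n0) = 0 := by rw [bForm_add_right, hE0, (hni 0).2.1, add_zero]
  have hF1 : bForm p q f (h0 + n0) = 0 := by rw [bForm_add_right, hF0, hnf 0, add_zero]
  have hE2 : bForm p q e (h0 + n0 + n1) = 0 := by rw [bForm_add_right, hE1, (hni 1).2.1, add_zero]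
  have hF2 : bForm p q f (h0 + n0 + n1) = 0 := by rw [bForm_add_right, hF1, hnf 1, add_zero]
  have hy3 : h0 + n0 + n1 + n2 = π (sig e y) := by
    have : π v = π (sig e y) - h0 := by rw [hv, hπsub]
    have h2 : π (sig e y) = h0 + π v := by rw [this]; abel
    rw [h2, hsum]; abel
  have b0 := norm_nonneg n0
  have b1 := norm_nonneg n1
  have b2 := norm_nonneg n2
  have hsm : ∀ (t : ℝ) (m : Fin (p + q + 2) → ℝ), |t| < 2 → ‖t • m‖ ≤ 2 * ‖m‖ := by
    intro t m ht
    rw [norm_smul, Real.norm_eq_abs]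
    gcongr
  have ms0 : ∀ t : ℝ, |t| < 2 → ∃ hne, Projectivization.mk ℝ (psi e f (h0 + t • n0)) hne ∈ Ω := by
    intro t ht
    refine hmem _ ?_ ?_ ?_
    · rw [bForm_add_right, bForm_smul_right, hE0, (hni 0).2.1]; simp
    · rw [bForm_add_right, bForm_smul_right, hF0, hnf 0]; simp
    · have e1 : h0 + t • n0 - h0 = t • n0 := by abel
      rw [e1]
      have := hsm t n0 ht
      linarith
  have ms1 : ∀ t : ℝ, |t| < 2 →
      ∃ hne, Projectivization.mk ℝ (psi e f (h0 + n0 + t • n1)) hne ∈ Ω := by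
    intro t ht
    refine hmem _ ?_ ?_ ?_
    · rw [bForm_add_right, bForm_smul_right, hE1, (hni 1).2.1]; simp
    · rw [bForm_add_right, bForm_smul_right, hF1, hnf 1]; simp
    · have e1 : h0 + n0 + t • n1 - h0 = n0 + t • n1 := by abel
      rw [e1]
      have := hsm t n1 ht
      have := norm_add_le n0 (t • n1)
      linarith
  have ms2 : ∀ t : ℝ, |t| < 2 →
      ∃ hne, Projectivization.mk ℝ (psi e f (h0 + n0 + n1 + t • n2)) hne ∈ Ω := by
    intro t ht
    refine hmem _ ?_ ?_ ?_
    · rw [bForm_add_right, bForm_smul_right, hE2, (hni 2).2.1]; simp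
    · rw [bForm_add_right, bForm_smul_right, hF2, hnf 2]; simp
    · have e1 : h0 + n0 + n1 + t • n2 - h0 = n0 + n1 + t • n2 := by abel
      rw [e1]
      have := hsm t n2 ht
      have := norm_add_le (n0 + n1) (t • n2)
      have := norm_add_le n0 n1
      linarith
  obtain ⟨k0, m0⟩ : ∃ hne, Projectivization.mk ℝ (psi e f h0) hne ∈ Ω := by
    simpa using ms0 0 (by norm_num)
  obtain ⟨k1, m1⟩ : ∃ hne, Projectivization.mk ℝ (psi e f (h0 + n0)) hne ∈ Ω := by
    simpa using ms1 0 (by norm_num)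
  obtain ⟨k2, m2⟩ : ∃ hne, Projectivization.mk ℝ (psi e f (h0 + n0 + n1)) hne ∈ Ω := by
    simpa using ms2 0 (by norm_num)
  have k3 : psi e f (h0 + n0 + n1 + n2) ≠ 0 := by
    rw [hy3, hψσ y hy]; exact ne_zero_of_bForm (bForm_sig (hΩ y hy))
  have ex : Projectivization.mk ℝ (psi e f h0) k0 = x := by
    simp only [hh0, hψσ x hx']
    exact mk_sig (hΩ x hx') _
  have ey : Projectivization.mk ℝ (psi e f (h0 + n0 + n1 + n2)) k3 = y := by
    simp only [hy3, hψσ y hy]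
    exact mk_sig (hΩ y hy) _
  refine ⟨_, m1, _, m2, ?_, ?_, ?_⟩
  · rw [← ex]
    exact seg_aux hee hff hef hE0 hF0 (hni 0).2.1 (hnf 0) (hni 0).1 ms0 k0 k1
  · exact seg_aux hee hff hef hE1 hF1 (hni 1).2.1 (hnf 1) (hni 1).1 ms1 k1 k2
  · rw [← ey]
    exact seg_aux hee hff hef hE2 hF2 (hni 2).2.1 (hnf 2) (hni 2).1 ms2 k2 k3

lemma Ch.split {Ω : Set (ℙ ℝ (Fin (p + q + 2) → ℝ))} {x y c} (h : Ch Ω x y c) :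
    ∀ r : ℝ, 0 < r → c < r ∨ ∃ z w c1 c2 c3, Ch Ω x z c1 ∧ c1 < r ∧ Step Ω z w c2 ∧ c2 ≤ c ∧
      Ch Ω w y c3 ∧ c3 ≤ c - r := by
  induction h with
  | nil => intro r hr; exact Or.inl hr
  | cons x y z c d h1 h2 h3 ih =>
    intro r hr
    have hd := h3.nonneg
    by_cases hc : r ≤ c
    · exact Or.inr ⟨x, y, 0, c, d, .nil x, hr, h1, by linarith, h3, by linarith⟩
    · push Not at hc
      rcases ih (r - c) (by linarith) with h | ⟨z', w, c1, c2, c3, g1, g2, g3, g4, g5, g6⟩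
      · left; linarith
      · exact Or.inr ⟨z', w, c + c1, c2, c3, .cons _ _ _ _ _ h1 h2 g1, by linarith, g3,
          by linarith, g5, by linarith⟩

lemma Seg.map {Ω : Set (ℙ ℝ (Fin (p + q + 2) → ℝ))} {g} (hg : g ∈ Conf (bForm p q) Ω) {x y}
    (h : Seg Ω x y) : Seg Ω (projMap g x) (projMap g y) := by
  rcases h with rfl | h
  · exact Or.inl rfl
  · exact Or.inr (h.map hg)

lemma einSet_closed : IsClosed (einSet (bForm p q)) := by
  rw [← (isOpenQuotientMap_mk (p := p) (q := q)).isQuotientMap.isClosed_preimage]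
  have : ((fun v : {v : Fin (p + q + 2) → ℝ // v ≠ 0} => Projectivization.mk ℝ v.1 v.2) ⁻¹'
      einSet (bForm p q)) = {v | bForm p q v.1 v.1 = 0} := by
    ext v; exact mk_mem_einSet v.1 v.2
  rw [this]
  exact isClosed_eq (bForm_continuous' continuous_subtype_val continuous_subtype_val)
    continuous_const

lemma proj_compact : CompactSpace (ℙ ℝ (Fin (p + q + 2) → ℝ)) := by
  have hS : IsCompact (Metric.sphere (0 : Fin (p + q + 2) → ℝ) 1) := isCompact_sphere _ _
  have hne : ∀ v ∈ Metric.sphere (0 : Fin (p + q + 2) → ℝ) 1, v ≠ 0 := by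
    rintro v hv rfl; simp at hv
  have := isCompact_iff_compactSpace.1 hS
  let F : Metric.sphere (0 : Fin (p + q + 2) → ℝ) 1 → ℙ ℝ (Fin (p + q + 2) → ℝ) :=
    fun v => Projectivization.mk ℝ v.1 (hne v.1 v.2)
  have hF : Continuous F := (isOpenQuotientMap_mk (p := p) (q := q)).continuous.comp
    (continuous_subtype_val.subtype_mk fun v => hne v.1 v.2)
  have hsurj : Function.Surjective F := by
    intro x
    have hx : ‖x.rep‖ ≠ 0 := norm_ne_zero_iff.2 x.rep_nonzero
    refine ⟨⟨‖x.rep‖⁻¹ • x.rep, ?_⟩, ?_⟩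
    · simp [norm_smul, hx]
    · simp only [F]
      conv_rhs => rw [← x.mk_rep]
      rw [Projectivization.mk_eq_mk_iff']
      exact ⟨_, rfl⟩
  exact hsurj.compactSpace hF

end Helpers

/-- Attraction at photon-extremal points of a proper quasi-homogeneous
domain. -/
theorem stmt_12 (p q : ℕ) (hp : 1 ≤ p) (hq : 1 ≤ q)
    (Ω : Set (ℙ ℝ (Fin (p + q + 2) → ℝ)))
    (hΩ : IsProperDomain (bForm p q) Ω)
    (hqh : IsQuasiHomogeneous (bForm p q) Ω)
    (a : ℙ ℝ (Fin (p + q + 2) → ℝ)) (ha : IsPhotonExtremal (bForm p q) Ω a)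
    (xs ys : ℕ → ℙ ℝ (Fin (p + q + 2) → ℝ))
    (hxs : ∀ k, xs k ∈ Ω) (hys : ∀ k, ys k ∈ Ω)
    (hxa : Tendsto xs atTop (𝓝 a))
    (M : ℝ) (hM : 0 < M)
    (hbd : ∀ k, markowitz (bForm p q) Ω (xs k) (ys k) ≤ ENNReal.ofReal M) :
    Tendsto ys atTop (𝓝 a) := by
  obtain ⟨⟨hein, hopen, -⟩, x0, hx0, hx0cl⟩ := hΩ
  obtain ⟨K, hKΩ, hK, hΩK⟩ := hqh
  obtain ⟨O, hO, hOΩ⟩ := isOpen_induced_iff.1 hopen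
  set e := x0.rep with he
  have he0 : e ≠ 0 := x0.rep_nonzero
  have hee : bForm p q e e = 0 := hx0
  have hcl : ∀ x ∈ closure Ω, bForm p q e x.rep ≠ 0 := by
    intro x hx h0
    have hxe : x ∈ einSet (bForm p q) := closure_minimal hein einSet_closed hx
    have : x ∈ closure Ω ∩ lightcone (bForm p q) x0 := ⟨hx, hxe, h0⟩
    rw [hx0cl] at this
    exact this
  have hΩe : ∀ x ∈ Ω, bForm p q e x.rep ≠ 0 := fun x hx => hcl x (subset_closure hx)
  have hΩO : ∀ x ∈ einSet (bForm p q), x ∈ Ω ↔ x ∈ O := by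
    intro x hx
    have := Set.ext_iff.1 hOΩ ⟨x, hx⟩
    exact this.symm
  obtain ⟨D, hD0, hD⟩ : ∃ D > 0, ∀ x ∈ Ω, ‖sig e x‖ ≤ D := by
    have := proj_compact (p := p) (q := q)
    have hc : IsCompact (sig e '' closure Ω) :=
      (isClosed_closure.isCompact).image_of_continuousOn fun x hx =>
        (sig_continuousAt e x (hcl x hx)).continuousWithinAt
    obtain ⟨D, hD0, hD⟩ := hc.isBounded.exists_pos_norm_le
    exact ⟨D, hD0, fun x hx => hD _ ⟨x, subset_closure hx, rfl⟩⟩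
  obtain ⟨ρ, hρ, hloc⟩ := local_conn hp hq he0 hee hO hΩO hein hΩe hK hKΩ
  -- the radius
  obtain ⟨r, hr0, hr1, hr2⟩ : ∃ r : ℝ, 0 < r ∧ r ≤ 1 ∧ 8 * D * r ≤ ρ := by
    refine ⟨min 1 (ρ / (8 * D)), lt_min one_pos (by positivity), min_le_left _ _, ?_⟩
    calc 8 * D * min 1 (ρ / (8 * D)) ≤ 8 * D * (ρ / (8 * D)) := by
          gcongr; exact min_le_right _ _
      _ = ρ := by field_simp
  have claimB : ∀ xs ys : ℕ → ℙ ℝ (Fin (p + q + 2) → ℝ), (∀ k, xs k ∈ Ω) → (∀ k, ys k ∈ Ω) →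
      Tendsto xs atTop (𝓝 a) → (∀ k, ∃ c < r, Ch Ω (xs k) (ys k) c) → Tendsto ys atTop (𝓝 a) := by
    intro xs ys hxs hys hxa hch
    have key : ∀ k, ∃ z1 ∈ Ω, ∃ z2 ∈ Ω, Seg Ω (xs k) z1 ∧ Seg Ω z1 z2 ∧ Seg Ω z2 (ys k) := by
      intro k
      obtain ⟨c, hcr, hc⟩ := hch k
      have hxk := hxs k
      rw [hΩK] at hxk
      simp only [Set.mem_iUnion] at hxk
      obtain ⟨g, hg, κ, hκ, hgκ⟩ := hxk
      have hg' := conf_symm hg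
      have hc' := hc.map hg'
      have e1 : projMap g.symm (xs k) = κ := by rw [← hgκ, projMap_symm_apply]
      rw [e1] at hc'
      have hlip := hc'.lip hΩe hD0 hD (by linarith)
      have hlt : ‖sig e κ - sig e (projMap g.symm (ys k))‖ < ρ := by
        refine lt_of_le_of_lt hlip (lt_of_lt_of_le ?_ hr2)
        gcongr
      obtain ⟨z1, hz1, z2, hz2, s1, s2, s3⟩ := hloc κ hκ _ (conf_mem hg' (hys k)) hlt
      have s1' := s1.map hg
      have s3' := s3.map hg
      rw [hgκ] at s1'
      rw [projMap_apply_symm] at s3'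
      exact ⟨_, conf_mem hg hz1, _, conf_mem hg hz2, s1', s2.map hg, s3'⟩
    choose z1 hz1 z2 hz2 s1 s2 s3 using key
    have t1 := claimA hcl hD hein ha hxs hz1 hxa _ s1
    have t2 := claimA hcl hD hein ha hz1 hz2 t1 _ s2
    exact claimA hcl hD hein ha hz2 hys t2 _ s3
  have main : ∀ n : ℕ, ∀ xs ys : ℕ → ℙ ℝ (Fin (p + q + 2) → ℝ), (∀ k, xs k ∈ Ω) →
      (∀ k, ys k ∈ Ω) → Tendsto xs atTop (𝓝 a) →
      (∀ k, ∃ c ≤ n * r, Ch Ω (xs k) (ys k) c) → Tendsto ys atTop (𝓝 a) := by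
    intro n
    induction n with
    | zero =>
      intro xs ys hxs hys hxa hch
      refine claimB xs ys hxs hys hxa fun k => ?_
      obtain ⟨c, hc, h⟩ := hch k
      refine ⟨c, ?_, h⟩
      simp at hc
      linarith
    | succ n ih =>
      intro xs ys hxs hys hxa hch
      have key : ∀ k, ∃ z ∈ Ω, ∃ w ∈ Ω, (∃ c < r, Ch Ω (xs k) z c) ∧
          (z = w ∨ Step Ω z w (((n + 1 : ℕ) : ℝ) * r)) ∧ (∃ c ≤ n * r, Ch Ω w (ys k) c) := by
        intro k
        obtain ⟨c, hc, h⟩ := hch k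
        rcases h.split r hr0 with h1 | ⟨z, w, c1, c2, c3, g1, g2, g3, g4, g5, g6⟩
        · exact ⟨ys k, hys k, ys k, hys k, ⟨c, h1, h⟩, Or.inl rfl,
            ⟨0, by positivity, .nil _⟩⟩
        · refine ⟨z, g3.mem.1, w, g3.mem.2, ⟨c1, g2, g1⟩, Or.inr ?_, ⟨c3, ?_, g5⟩⟩
          · obtain ⟨α, s, t, q1, q2, q3, q4, q5, q6⟩ := g3
            exact ⟨α, s, t, q1, q2, q3, q4, q5, by linarith⟩
          · push_cast at hc; linarith
      choose z hz w hw h1 h2 h3 using key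
      have t1 := claimB xs z hxs hz hxa h1
      have t2 := claimA hcl hD hein ha hz hw t1 _ h2
      exact ih w ys hw hys t2 h3
  obtain ⟨n, hn⟩ := exists_nat_ge ((M + 1) / r)
  refine main n xs ys hxs hys hxa fun k => ?_
  have hlt : markowitz (bForm p q) Ω (xs k) (ys k) < ENNReal.ofReal (M + 1) :=
    lt_of_le_of_lt (hbd k) ((ENNReal.ofReal_lt_ofReal_iff (by linarith)).2 (by linarith))
  unfold markowitz at hlt
  obtain ⟨_, ⟨N, c, -, hc, rfl⟩, hcl'⟩ := sInf_lt_iff.1 hlt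
  rw [ENNReal.ofReal_lt_ofReal_iff (by linarith)] at hcl'
  refine ⟨c, ?_, Ch.of_chain N hc⟩
  rw [div_le_iff₀ hr0] at hn
  linarith
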